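/- Let r ≥ 0, n ≥ 2 and i ≥ 1 be integers with i ≤ n/2, and let p be a prime such that p divides the product n(n−1)⋯(n−i+1)·(r+1)(r+2)⋯(r+i), p ∤ C(n+r, r), and p > i. Then 𝓛_n^{⟨r⟩}(x) has no monic factor in ℚ[x] of degree exactly i. -/

import Mathlib

open Polynomial

/-- The monic integer polynomial `𝓛_n^{⟨r⟩}(x) = ∑_{j=0}^{n} C(n,j)·(r+1)⋯(r+n−j)·x^j`,
viewed as a polynomial over `ℚ`. -/
noncomputable def laguerreL (n r : ℕ) : Polynomial ℚ :=
  ∑ j ∈ Finset.range (n + 1),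
    Polynomial.C ((n.choose j : ℚ) * ∏ t ∈ Finset.Icc 1 (n - j), ((r : ℚ) + (t : ℚ))) *
      Polynomial.X ^ j

/-- The coefficients of `laguerreL n r`, as natural numbers. -/
def laguerreCoeff (n r j : ℕ) : ℕ :=
  n.descFactorial (n - j) * (r + (n - j)).choose (n - j)

theorem prod_Icc_add_eq_ascFactorial (r k : ℕ) :
    ∏ t ∈ Finset.Icc 1 k, (r + t) = (r + 1).ascFactorial k := by
  induction k with
  | zero => simp
  | succ k ih =>
    rw [Finset.prod_Icc_succ_top (by omega), ih, Nat.ascFactorial_succ]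
    ring

theorem choose_mul_prod_Icc_eq_laguerreCoeff {n r j : ℕ} (hj : j ≤ n) :
    n.choose j * ∏ t ∈ Finset.Icc 1 (n - j), (r + t) = laguerreCoeff n r j := by
  rw [prod_Icc_add_eq_ascFactorial, Nat.ascFactorial_eq_factorial_mul_choose, laguerreCoeff,
    Nat.descFactorial_eq_factorial_mul_choose, Nat.choose_symm hj]
  ring

theorem laguerreL_eq_sum_laguerreCoeff (n r : ℕ) :
    laguerreL n r = ∑ j ∈ Finset.range (n + 1), C (laguerreCoeff n r j : ℚ) * X ^ j := by
  refine Finset.sum_congr rfl fun j hj => ?_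
  rw [← choose_mul_prod_Icc_eq_laguerreCoeff (Finset.mem_range_succ_iff.mp hj)]
  push_cast
  rfl

/-- `laguerreL n r` as a polynomial with integer coefficients. -/
noncomputable def laguerreInt (n r : ℕ) : ℤ[X] :=
  ∑ j ∈ Finset.range (n + 1), C (laguerreCoeff n r j : ℤ) * X ^ j

theorem map_laguerreInt (n r : ℕ) :
    (laguerreInt n r).map (algebraMap ℤ ℚ) = laguerreL n r := by
  simp [laguerreInt, laguerreL_eq_sum_laguerreCoeff, Polynomial.map_sum]

theorem coeff_laguerreInt {n r j : ℕ} (hj : j ≤ n) :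
    (laguerreInt n r).coeff j = laguerreCoeff n r j := by
  simp only [laguerreInt, finsetSum_coeff, coeff_C_mul_X_pow]
  rw [Finset.sum_ite_eq, if_pos (by simpa [Nat.lt_succ_iff] using hj)]

theorem natDegree_laguerreInt_le (n r : ℕ) : (laguerreInt n r).natDegree ≤ n :=
  natDegree_sum_le_of_forall_le _ _ fun _ hj =>
    (natDegree_C_mul_X_pow_le _ _).trans (Finset.mem_range_succ_iff.mp hj)

theorem coeff_laguerreInt_self (n r : ℕ) : (laguerreInt n r).coeff n = 1 := by
  simp [coeff_laguerreInt, laguerreCoeff]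

theorem monic_laguerreInt (n r : ℕ) : (laguerreInt n r).Monic :=
  monic_of_natDegree_le_of_coeff_eq_one n (natDegree_laguerreInt_le n r)
    (coeff_laguerreInt_self n r)

theorem natDegree_laguerreInt (n r : ℕ) : (laguerreInt n r).natDegree = n :=
  le_antisymm (natDegree_laguerreInt_le n r)
    (le_natDegree_of_ne_zero (by simp [coeff_laguerreInt_self]))

theorem dvd_laguerreCoeff {n r i j p : ℕ} (hp : p.Prime) (hij : i + j ≤ n)
    (hdvd : p ∣ (∏ s ∈ Finset.range i, (n - s)) * ∏ t ∈ Finset.Icc 1 i, (r + t)) :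
    p ∣ laguerreCoeff n r j := by
  rcases hp.dvd_mul.mp hdvd with h | h
  · refine (h.trans ?_).mul_right _
    rw [Nat.descFactorial_eq_prod_range]
    exact Finset.prod_dvd_prod_of_subset _ _ _ (Finset.range_mono (by omega))
  · rw [← choose_mul_prod_Icc_eq_laguerreCoeff (by omega)]
    exact (h.trans (Finset.prod_dvd_prod_of_subset _ _ _
      (Finset.Icc_subset_Icc_right (by omega)))).mul_left _

theorem factorial_mul_laguerreCoeff {n r j : ℕ} (hj : j ≤ n) :
    j.factorial * laguerreCoeff n r j = n.factorial * (r + (n - j)).choose (n - j) := by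
  have h := Nat.factorial_mul_descFactorial (Nat.sub_le n j)
  rw [Nat.sub_sub_self hj] at h
  rw [laguerreCoeff, ← mul_assoc, h]

/-- If `p` divides the coefficients of `g * h` up to index `h.natDegree`, with `h` monic, then `p`
divides the constant coefficient of `g`. -/
theorem dvd_coeff_zero_of_dvd_coeff_mul {p : ℕ} (hp : p.Prime) {g h : ℤ[X]} (hh : h.Monic)
    (hdvd : ∀ j ≤ h.natDegree, (p : ℤ) ∣ (g * h).coeff j) : (p : ℤ) ∣ g.coeff 0 := by
  have := Fact.mk hp
  let φ := Int.castRingHom (ZMod p)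
  by_contra hg
  have hX : ¬ X ∣ g.map φ := by
    rw [X_dvd_iff, coeff_map]
    simpa [φ, ZMod.intCast_zmod_eq_zero_iff_dvd] using hg
  have hpow : X ^ (h.natDegree + 1) ∣ g.map φ * h.map φ := by
    rw [← Polynomial.map_mul, X_pow_dvd_iff]
    intro j hj
    rw [coeff_map]
    exact (ZMod.intCast_zmod_eq_zero_iff_dvd _ p).mpr (hdvd j (by omega))
  have hle := natDegree_le_of_dvd (prime_X.pow_dvd_of_dvd_mul_left _ hX hpow) (hh.map φ).ne_zero
  rw [natDegree_X_pow, hh.natDegree_map] at hle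
  omega

theorem Multiset.exists_norm_pow_card_le {K : Type*} [NormedField K] (s : Multiset K)
    (hs : s ≠ 0) : ∃ a ∈ s, ‖a‖ ^ s.card ≤ ‖s.prod‖ := by
  classical
  obtain ⟨a, ha, hmin⟩ := s.toFinset.exists_min_image norm
    ((Multiset.toFinset_nonempty).mpr hs)
  refine ⟨a, Multiset.mem_toFinset.mp ha, ?_⟩
  have key : ∀ t : Multiset K, (∀ b ∈ t, ‖a‖ ≤ ‖b‖) → ‖a‖ ^ t.card ≤ ‖t.prod‖ := by
    intro t
    induction t using Multiset.induction_on with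
    | empty => simp
    | cons b t ih =>
      intro h
      rw [Multiset.card_cons, Multiset.prod_cons, norm_mul, pow_succ']
      exact mul_le_mul (h b (Multiset.mem_cons_self b t))
        (ih fun c hc => h c (Multiset.mem_cons_of_mem hc)) (by positivity) (norm_nonneg _)
  exact key s fun b hb => hmin b (Multiset.mem_toFinset.mpr hb)

theorem exists_root_norm_pow_natDegree_le {K : Type*} [NormedField K] [IsAlgClosed K] {g : K[X]}
    (hg : g.Monic) (hdeg : g.natDegree ≠ 0) :
    ∃ a, g.IsRoot a ∧ ‖a‖ ^ g.natDegree ≤ ‖g.coeff 0‖ := by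
  have hsplit := IsAlgClosed.splits g
  have hcard : g.roots.card = g.natDegree := hsplit.natDegree_eq_card_roots.symm
  obtain ⟨a, ha, hle⟩ := g.roots.exists_norm_pow_card_le (by
    intro h
    simp [h] at hcard
    omega)
  refine ⟨a, isRoot_of_mem_roots ha, ?_⟩
  rw [hsplit.coeff_zero_eq_prod_roots_of_monic hg, norm_mul, norm_pow, norm_neg, norm_one, one_pow,
    one_mul, ← hcard]
  exact hle

theorem sum_range_succ_ne_zero_of_norm_lt {K : Type*} [NormedField K] [IsUltrametricDist K]
    {n : ℕ} {f : ℕ → K} (h0 : f 0 ≠ 0) (h : ∀ j, 1 ≤ j → j ≤ n → ‖f j‖ < ‖f 0‖) :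
    ∑ j ∈ Finset.range (n + 1), f j ≠ 0 := by
  intro hsum
  rw [Finset.sum_range_succ', add_comm, add_eq_zero_iff_eq_neg] at hsum
  rcases Nat.eq_zero_or_pos n with rfl | hn
  · simp at hsum
    exact h0 hsum
  · obtain ⟨j, hj, hle⟩ := IsUltrametricDist.exists_norm_finsetSum_le_of_nonempty
      (Finset.nonempty_range_iff.mpr hn.ne') (fun j => f (j + 1))
    rw [← norm_neg, ← hsum] at hle
    exact absurd hle (not_le.mpr (h (j + 1) (by omega) (Finset.mem_range.mp hj)))

theorem PadicAlgCl.norm_natCast (p : ℕ) [Fact p.Prime] (m : ℕ) :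
    ‖(m : PadicAlgCl p)‖ = ‖(m : ℚ_[p])‖ := by
  rw [← map_natCast (algebraMap ℚ_[p] (PadicAlgCl p)), PadicAlgCl.norm_extends]

theorem PadicAlgCl.norm_natCast_le_one (p : ℕ) [Fact p.Prime] (m : ℕ) :
    ‖(m : PadicAlgCl p)‖ ≤ 1 := by
  rw [PadicAlgCl.norm_natCast]
  exact_mod_cast Padic.norm_int_le_one (p := p) m

theorem pow_lt_padicNorm_factorial {p i j : ℕ} [Fact p.Prime] (hip : i < p)
    (hj : j ≠ 0) {x : ℝ} (hx0 : 0 ≤ x) (hx : x ^ i ≤ (p : ℝ)⁻¹) :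
    x ^ j < ‖(j.factorial : ℚ_[p])‖ := by
  have hp1 : (1 : ℝ) < p := by exact_mod_cast (Fact.out : p.Prime).one_lt
  have hv : padicValNat p j.factorial * i < j :=
    lt_of_le_of_lt (by rw [mul_comm]; gcongr; omega)
      (sub_one_mul_padicValNat_factorial_lt_of_ne_zero p hj)
  rw [Padic.norm_eq_zpow_neg_valuation (by exact_mod_cast j.factorial_ne_zero),
    Padic.valuation_natCast, zpow_neg, zpow_natCast, ← inv_pow]
  refine lt_of_pow_lt_pow_left₀ i (by positivity) ?_
  calc (x ^ j) ^ i = (x ^ i) ^ j := by rw [← pow_mul, ← pow_mul, mul_comm]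
    _ ≤ ((p : ℝ)⁻¹) ^ j := by gcongr
    _ < ((p : ℝ)⁻¹) ^ (padicValNat p j.factorial * i) :=
      pow_lt_pow_right_of_lt_one₀ (by positivity) (inv_lt_one_of_one_lt₀ hp1) hv
    _ = _ := pow_mul _ _ _

/-- Every `p`-adic root of `laguerreL n r` has valuation less than `1 / i`. -/
theorem sum_laguerreCoeff_mul_pow_ne_zero {n r i p : ℕ} [Fact p.Prime] (hip : i < p)
    (hpc : ¬ p ∣ (n + r).choose r) {a : PadicAlgCl p} (ha : ‖a‖ ^ i ≤ (p : ℝ)⁻¹) :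
    ∑ j ∈ Finset.range (n + 1), (laguerreCoeff n r j : PadicAlgCl p) * a ^ j ≠ 0 := by
  have hchoose : ‖((r + n).choose n : PadicAlgCl p)‖ = 1 := by
    rw [PadicAlgCl.norm_natCast, Padic.norm_natCast_eq_one_iff,
      (Fact.out : p.Prime).coprime_iff_not_dvd, ← Nat.choose_symm_add, add_comm]
    exact hpc
  have hzero : ‖(laguerreCoeff n r 0 : PadicAlgCl p)‖ = ‖(n.factorial : PadicAlgCl p)‖ := by
    have h := factorial_mul_laguerreCoeff (r := r) n.zero_le
    rw [Nat.factorial_zero, one_mul, Nat.sub_zero] at h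
    rw [h, Nat.cast_mul, norm_mul, hchoose, mul_one]
  have hpos : 0 < ‖(laguerreCoeff n r 0 : PadicAlgCl p)‖ := by
    rw [hzero, norm_pos_iff]
    exact_mod_cast n.factorial_ne_zero
  refine sum_range_succ_ne_zero_of_norm_lt (by simpa using hpos) fun j hj hjn => ?_
  have hfac : ‖a‖ ^ j < ‖(j.factorial : PadicAlgCl p)‖ := by
    rw [PadicAlgCl.norm_natCast]
    exact pow_lt_padicNorm_factorial hip (by omega) (norm_nonneg a) ha
  have hcoeff : ‖(j.factorial : PadicAlgCl p)‖ * ‖(laguerreCoeff n r j : PadicAlgCl p)‖ ≤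
      ‖(laguerreCoeff n r 0 : PadicAlgCl p)‖ := by
    rw [← norm_mul, ← Nat.cast_mul, factorial_mul_laguerreCoeff hjn, Nat.cast_mul, norm_mul, hzero]
    exact mul_le_of_le_one_right (norm_nonneg _) (PadicAlgCl.norm_natCast_le_one p _)
  rw [pow_zero, mul_one, norm_mul, norm_pow]
  refine lt_of_mul_lt_mul_left ?_ (norm_nonneg (j.factorial : PadicAlgCl p))
  calc _ = ‖(j.factorial : PadicAlgCl p)‖ * ‖(laguerreCoeff n r j : PadicAlgCl p)‖ * ‖a‖ ^ j := by
        ring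
    _ ≤ ‖(laguerreCoeff n r 0 : PadicAlgCl p)‖ * ‖a‖ ^ j := by gcongr
    _ < ‖(laguerreCoeff n r 0 : PadicAlgCl p)‖ * ‖(j.factorial : PadicAlgCl p)‖ := by gcongr
    _ = _ := mul_comm _ _

theorem laguerre_no_factor_of_degree_eq (n r i : ℕ) (hn : 2 ≤ n) (hi : 1 ≤ i) (hi2 : 2 * i ≤ n)
    (p : ℕ) (hp : p.Prime)
    (hdvd : p ∣ (∏ s ∈ Finset.range i, (n - s)) * ∏ t ∈ Finset.Icc 1 i, (r + t))
    (hpc : ¬ p ∣ (n + r).choose r) (hpi : i < p) :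
    ¬ ∃ g : Polynomial ℚ, g.Monic ∧ g ∣ laguerreL n r ∧ g.natDegree = i := by
  rintro ⟨g, hg, hgdvd, hdeg⟩
  have := Fact.mk hp
  rw [← map_laguerreInt] at hgdvd
  obtain ⟨g', hg'⟩ :=
    IsIntegrallyClosed.eq_map_mul_C_of_dvd ℚ (monic_laguerreInt n r) hgdvd
  rw [hg.leadingCoeff, C_1, mul_one] at hg'
  subst hg'
  have hinj : Function.Injective (algebraMap ℤ ℚ) := (algebraMap ℤ ℚ).injective_int
  replace hg : g'.Monic := monic_of_injective hinj hg
  rw [hg.natDegree_map] at hdeg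
  obtain ⟨h, hgh⟩ := (map_dvd_map _ hinj hg).mp hgdvd
  have hh : h.Monic := hg.of_mul_monic_left (hgh ▸ monic_laguerreInt n r)
  have hdegh : i + h.natDegree = n := by
    rw [← hdeg, ← hg.natDegree_mul hh, ← hgh, natDegree_laguerreInt]
  have hp0 : (p : ℤ) ∣ g'.coeff 0 := by
    refine dvd_coeff_zero_of_dvd_coeff_mul hp hh fun j hj => ?_
    rw [← hgh, coeff_laguerreInt (by omega)]
    exact_mod_cast dvd_laguerreCoeff hp (by omega) hdvd
  let ψ := Int.castRingHom (PadicAlgCl p)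
  obtain ⟨a, ha, hle⟩ := exists_root_norm_pow_natDegree_le (hg.map ψ)
    (by rw [hg.natDegree_map]; omega)
  rw [hg.natDegree_map, hdeg, coeff_map] at hle
  have hnorm : ‖ψ (g'.coeff 0)‖ ≤ (p : ℝ)⁻¹ := by
    obtain ⟨c, hc⟩ := hp0
    rw [hc, map_mul, map_natCast, norm_mul, PadicAlgCl.norm_natCast, Padic.norm_p, eq_intCast,
      ← map_intCast (algebraMap ℚ_[p] (PadicAlgCl p)), PadicAlgCl.norm_extends]
    exact mul_le_of_le_one_right (by positivity) (Padic.norm_int_le_one c)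
  refine sum_laguerreCoeff_mul_pow_ne_zero (n := n) (r := r) hpi hpc
    (hle.trans hnorm) ?_
  have hroot : ((laguerreInt n r).map ψ).eval a = 0 := by
    rw [hgh, Polynomial.map_mul, eval_mul, ha.eq_zero, zero_mul]
  simpa [laguerreInt, Polynomial.map_sum, eval_finsetSum] using hroot
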